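/- arXiv:2203.06908 — 2 statements merged into one kernel-verified Lean document; each statement's English description precedes it below -/
import Mathlib

section
/- Let q be real with 0 < |q| < 1. For (r,s,t) ∈ ℕ×ℕ×ℤ, put n = (r+s+|t|)/2, i = (−r+s−t)/2, j = (−r+s+t)/2 (an element of Γ). Then (−1)^{t₋} · U(λ_q(α_q) e^n_{i,j}) = q^{2s+|t|+1} · [g(r+t₋+1)g(r+t₊+1)/(g(r+s+|t|+1)g(r+s+|t|+2))] · e(r+1,s,t) + [g(s+t₊)g(s+t₋)/(g(r+s+|t|)g(r+s+|t|+1))] · e(r,s−1,t), where the second summand is omitted when (r,s,t) = (0,0,0) (equivalently when n = 0), and e(r,−1,t) := 0. Equivalently, this computes U λ_q(α_q) U* e(r,s,t). -/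
noncomputable section

/-- The lattice Γ = {(n,i,j) : 2n ∈ ℕ, i,j ∈ {−n,…,n}}, in the integer coordinates
(m,a,b) = (2n, n+i, n+j): Γ = {(m,a,b) ∈ ℕ³ : a ≤ m ∧ b ≤ m}. -/
abbrev GammaIdx : Type := {x : ℕ × ℕ × ℕ // x.2.1 ≤ x.1 ∧ x.2.2 ≤ x.1}

/-- ℓ²(Γ) -/
abbrev l2G : Type := lp (fun _ : GammaIdx => ℂ) 2

/-- ℓ²(ℕ×ℕ×ℤ) -/
abbrev l2Z3 : Type := lp (fun _ : ℕ × ℕ × ℤ => ℂ) 2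

/-- The canonical orthonormal basis vector e^n_{i,j} of ℓ²(Γ), in coordinates
(m,a,b) = (2n, n+i, n+j); by convention it is 0 when (m,a,b) ∉ Γ. -/
def eG (m a b : ℕ) : l2G :=
  if h : a ≤ m ∧ b ≤ m then lp.single 2 (⟨(m, a, b), h⟩ : GammaIdx) 1 else 0

/-- The canonical orthonormal basis vector e(r,s,t) of ℓ²(ℕ×ℕ×ℤ); by convention
it is 0 when r < 0 or s < 0. -/
def eZ (r s t : ℤ) : l2Z3 :=
  if 0 ≤ r ∧ 0 ≤ s then lp.single 2 (r.toNat, s.toNat, t) 1 else 0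

/-- g(k) = (1 − q^{2k})^{1/2}  (so g(0) = 0). -/
def gq (q : ℝ) (k : ℕ) : ℝ := Real.sqrt (1 - q ^ (2 * k))

/-- a₊(n,i,j) = q^{2n+i+j+1} g(n−j+1)g(n−i+1)/(g(2n+1)g(2n+2)), in coordinates
(m,a,b) = (2n, n+i, n+j): a₊ = q^{a+b+1} g(m−b+1)g(m−a+1)/(g(m+1)g(m+2)). -/
def aP (q : ℝ) (m a b : ℕ) : ℝ :=
  q ^ (a + b + 1) * gq q (m - b + 1) * gq q (m - a + 1) / (gq q (m + 1) * gq q (m + 2))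

/-- a₋(n,i,j) = g(n+j)g(n+i)/(g(2n)g(2n+1)), i.e. a₋ = g(b)g(a)/(g(m)g(m+1)) (for m ≥ 1). -/
def aM (q : ℝ) (m a b : ℕ) : ℝ :=
  gq q b * gq q a / (gq q m * gq q (m + 1))

/-- b₊(n,i,j) = −q^{n+j} g(n−j+1)g(n+i+1)/(g(2n+1)g(2n+2)), i.e.
b₊ = −q^b g(m−b+1)g(a+1)/(g(m+1)g(m+2)). -/
def bP (q : ℝ) (m a b : ℕ) : ℝ :=
  -(q ^ b * gq q (m - b + 1) * gq q (a + 1)) / (gq q (m + 1) * gq q (m + 2))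

/-- b₋(n,i,j) = q^{n+i} g(n+j)g(n−i)/(g(2n)g(2n+1)), i.e.
b₋ = q^a g(b)g(m−a)/(g(m)g(m+1)) (for m ≥ 1). -/
def bM (q : ℝ) (m a b : ℕ) : ℝ :=
  q ^ a * gq q b * gq q (m - a) / (gq q m * gq q (m + 1))

/-- λ_q(α_q): in coordinates (m,a,b), e(m,a,b) ↦ a₊ e(m+1,a,b) + a₋ e(m−1,a−1,b−1),
the a₋ term being omitted when m = 0 (i.e. n = 0). -/
def IsLambdaAlpha (q : ℝ) (L : l2G →L[ℂ] l2G) : Prop :=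
  ∀ m a b : ℕ, a ≤ m → b ≤ m →
    L (eG m a b) = ((aP q m a b : ℝ) : ℂ) • eG (m + 1) a b +
      (if 1 ≤ m then ((aM q m a b : ℝ) : ℂ) • eG (m - 1) (a - 1) (b - 1) else 0)

/-- λ_q(β_q): in coordinates (m,a,b), e(m,a,b) ↦ b₊ e(m+1,a+1,b) + b₋ e(m−1,a,b−1),
the b₋ term being omitted when m = 0 (i.e. n = 0). -/
def IsLambdaBeta (q : ℝ) (L : l2G →L[ℂ] l2G) : Prop :=
  ∀ m a b : ℕ, a ≤ m → b ≤ m →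
    L (eG m a b) = ((bP q m a b : ℝ) : ℂ) • eG (m + 1) (a + 1) b +
      (if 1 ≤ m then ((bM q m a b : ℝ) : ℂ) • eG (m - 1) a (b - 1) else 0)

/-- The defining property of the unitary U : ℓ²(Γ) → ℓ²(ℕ×ℕ×ℤ):
U e^n_{i,j} = (−1)^{max(i,j)−j} e(n−max(i,j), n+min(i,j), j−i), i.e.
U e(m,a,b) = (−1)^{max(a,b)−b} e(m−max(a,b), min(a,b), b−a). -/
def IsU (U : l2G ≃ₗᵢ[ℂ] l2Z3) : Prop :=
  ∀ m a b : ℕ, a ≤ m → b ≤ m →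
    U (eG m a b) = ((-1 : ℂ) ^ (max a b - b)) •
      eZ ((m : ℤ) - (max a b : ℤ)) (min a b) ((b : ℤ) - (a : ℤ))

theorem IsU.apply_eG {U : l2G ≃ₗᵢ[ℂ] l2Z3} (hU : IsU U) (r s : ℕ) (t : ℤ) :
    U (eG (r + s + t.natAbs) (s + (-t).toNat) (s + t.toNat)) =
      ((-1 : ℂ) ^ (-t).toNat) • eZ r s t := by
  rw [hU _ _ _ (by omega) (by omega)]
  have hexp : max (s + (-t).toNat) (s + t.toNat) - (s + t.toNat) = (-t).toNat := by omega
  rw [hexp]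
  congr 2 <;> omega

theorem gq_zero (q : ℝ) : gq q 0 = 0 := by
  simp [gq]

theorem neg_one_pow_smul_self_smul (k : ℕ) (x : l2Z3) :
    ((-1 : ℂ) ^ k) • ((-1 : ℂ) ^ k) • x = x := by
  rw [smul_smul, ← mul_pow]
  simp

theorem aP_eq (q : ℝ) (r s : ℕ) (t : ℤ) :
    aP q (r + s + t.natAbs) (s + (-t).toNat) (s + t.toNat) =
      q ^ (2 * s + t.natAbs + 1) *
        (gq q (r + (-t).toNat + 1) * gq q (r + t.toNat + 1) /
          (gq q (r + s + t.natAbs + 1) * gq q (r + s + t.natAbs + 2))) := by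
  have hexp : s + (-t).toNat + (s + t.toNat) + 1 = 2 * s + t.natAbs + 1 := by omega
  have hb : r + s + t.natAbs - (s + t.toNat) = r + (-t).toNat := by omega
  have ha : r + s + t.natAbs - (s + (-t).toNat) = r + t.toNat := by omega
  rw [aP, hexp, hb, ha, mul_assoc, mul_div_assoc]

theorem IsU.aM_smul_apply_eG {U : l2G ≃ₗᵢ[ℂ] l2Z3} (hU : IsU U) (q : ℝ) (r s : ℕ) (t : ℤ) :
    ((aM q (r + s + t.natAbs) (s + (-t).toNat) (s + t.toNat) : ℝ) : ℂ) •
        U (eG (r + s + t.natAbs - 1) (s + (-t).toNat - 1) (s + t.toNat - 1)) =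
      ((-1 : ℂ) ^ (-t).toNat) •
        ((aM q (r + s + t.natAbs) (s + (-t).toNat) (s + t.toNat) : ℝ) : ℂ) •
          eZ r ((s : ℤ) - 1) t := by
  rcases s with _ | s
  · have haM : aM q (r + 0 + t.natAbs) (0 + (-t).toNat) (0 + t.toNat) = 0 := by
      rcases le_total t 0 with ht | ht
      · simp [aM, Int.toNat_of_nonpos ht, gq_zero]
      · simp [aM, Int.toNat_of_nonpos (neg_nonpos.mpr ht), gq_zero]
    rw [haM, Complex.ofReal_zero, zero_smul, zero_smul, smul_zero]
  · have hm : r + (s + 1) + t.natAbs - 1 = r + s + t.natAbs := by omega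
    have ha : s + 1 + (-t).toNat - 1 = s + (-t).toNat := by omega
    have hb : s + 1 + t.toNat - 1 = s + t.toNat := by omega
    have hs : ((s + 1 : ℕ) : ℤ) - 1 = s := by omega
    rw [hm, ha, hb, hs, hU.apply_eG, smul_comm]

/-- for (r,s,t) ∈ ℕ×ℕ×ℤ, with (n,i,j) ∈ Γ corresponding to
(m,a,b) = (r+s+|t|, s+t₋, s+t₊):
(−1)^{t₋} U(λ_q(α_q) e^n_{i,j}) =
  q^{2s+|t|+1} [g(r+t₋+1)g(r+t₊+1)/(g(r+s+|t|+1)g(r+s+|t|+2))] e(r+1,s,t)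
  + [g(s+t₊)g(s+t₋)/(g(r+s+|t|)g(r+s+|t|+1))] e(r,s−1,t),
the second summand being omitted when (r,s,t) = (0,0,0), with e(r,−1,t) := 0. -/
theorem stmt10 (q : ℝ) (h0 : 0 < |q|) (h1 : |q| < 1)
    (U : l2G ≃ₗᵢ[ℂ] l2Z3) (hU : IsU U)
    (Lα : l2G →L[ℂ] l2G) (hLα : IsLambdaAlpha q Lα)
    (r s : ℕ) (t : ℤ) :
    ((-1 : ℂ) ^ (-t).toNat) •
        U (Lα (eG (r + s + t.natAbs) (s + (-t).toNat) (s + t.toNat))) =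
      ((q ^ (2 * s + t.natAbs + 1) *
          (gq q (r + (-t).toNat + 1) * gq q (r + t.toNat + 1) /
            (gq q (r + s + t.natAbs + 1) * gq q (r + s + t.natAbs + 2))) : ℝ) : ℂ) •
          eZ ((r : ℤ) + 1) (s : ℤ) t +
      (if r = 0 ∧ s = 0 ∧ t = 0 then 0 else
        ((gq q (s + t.toNat) * gq q (s + (-t).toNat) /
            (gq q (r + s + t.natAbs) * gq q (r + s + t.natAbs + 1)) : ℝ) : ℂ) •
          eZ (r : ℤ) ((s : ℤ) - 1) t) := by
  have hm : r + s + t.natAbs + 1 = (r + 1) + s + t.natAbs := by omega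
  have hcond : 1 ≤ r + s + t.natAbs ↔ ¬(r = 0 ∧ s = 0 ∧ t = 0) := by omega
  have hplus : U (eG (r + s + t.natAbs + 1) (s + (-t).toNat) (s + t.toNat)) =
      ((-1 : ℂ) ^ (-t).toNat) • eZ ((r : ℤ) + 1) s t := by
    rw [hm, hU.apply_eG, Nat.cast_succ]
  rw [hLα _ _ _ (by omega) (by omega), map_add, map_smul, smul_add, hplus, smul_comm _ _ (eZ _ _ _),
    neg_one_pow_smul_self_smul, aP_eq]
  congr 1
  by_cases h : r = 0 ∧ s = 0 ∧ t = 0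
  · rw [if_pos h, if_neg (by simpa [hcond] using h), map_zero, smul_zero]
  · rw [if_neg h, if_pos (hcond.mpr h), map_smul, hU.aM_smul_apply_eG,
      neg_one_pow_smul_self_smul, aM]
end
end

section
/- Let q be real with 0 < |q| < 1. The diagonal operator on ℓ²(ℕ×ℕ×ℤ) with symbol d₂(r,s,t) = g(s+1)g(s+|t|+1) · [1/(g(r+s+|t|+1)g(r+s+|t|+2)) − 1] is a compact operator. (Moreover there is a constant C > 0 with |d₂(r,s,t)| ≤ C·|q|^{2r+2s+2|t|} for all (r,s,t).) -/
noncomputable section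

/-- The canonical orthonormal basis vector e(r,s,t) of ℓ²(ℕ×ℕ×ℤ). -/
def e3 (r s : ℕ) (t : ℤ) : l2Z3 := lp.single 2 (r, s, t) 1

/-- d₂(r,s,t) = g(s+1)g(s+|t|+1) [1/(g(r+s+|t|+1)g(r+s+|t|+2)) − 1]. -/
def d2 (q : ℝ) (r s : ℕ) (t : ℤ) : ℝ :=
  gq q (s + 1) * gq q (s + t.natAbs + 1) *
    (1 / (gq q (r + s + t.natAbs + 1) * gq q (r + s + t.natAbs + 2)) - 1)

section Diagonal

variable {ι : Type*} [DecidableEq ι]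

/-- The coordinate projection of `ℓ²(ι)` onto the line spanned by the `i`-th basis vector. -/
def coordProj (i : ι) : lp (fun _ : ι => ℂ) 2 →L[ℂ] lp (fun _ : ι => ℂ) 2 :=
  (lp.singleContinuousLinearMap ℂ (fun _ : ι => ℂ) 2 i).comp
    (lp.evalCLM ℂ (fun _ : ι => ℂ) 2 i)

theorem coordProj_apply (i : ι) (x : lp (fun _ : ι => ℂ) 2) :
    coordProj i x = lp.single 2 i (x i) := rfl

theorem norm_coordProj_le (i : ι) : ‖coordProj i‖ ≤ 1 := by
  refine ContinuousLinearMap.opNorm_le_bound _ zero_le_one fun x => ?_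
  rw [coordProj_apply, lp.norm_single (by norm_num), one_mul]
  exact lp.norm_apply_le_norm (by norm_num) x i

theorem isCompactOperator_coordProj (i : ι) : IsCompactOperator (coordProj i) :=
  (isCompactOperator_of_locallyCompactSpace_dom
    (lp.evalCLM ℂ (fun _ : ι => ℂ) 2 i)).clm_comp
    (lp.singleContinuousLinearMap ℂ (fun _ : ι => ℂ) 2 i)

/-- A diagonal operator on `ℓ²(ι)` with absolutely summable symbol exists and is compact. -/
theorem exists_isCompactOperator_diagonal {d : ι → ℂ} (hd : Summable fun i => ‖d i‖) :
    ∃ D : lp (fun _ : ι => ℂ) 2 →L[ℂ] lp (fun _ : ι => ℂ) 2,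
      (∀ i, D (lp.single 2 i 1) = d i • lp.single 2 i 1) ∧ IsCompactOperator D := by
  have hs : Summable fun i => d i • coordProj i := by
    refine Summable.of_norm_bounded hd fun i => ?_
    rw [norm_smul]
    exact mul_le_of_le_one_right (norm_nonneg _) (norm_coordProj_le i)
  refine ⟨∑' i, d i • coordProj i, fun j => ?_, ?_⟩
  · have h := hs.hasSum.mapL
      (ContinuousLinearMap.apply ℂ (lp (fun _ : ι => ℂ) 2)
        (lp.single 2 j 1 : lp (fun _ : ι => ℂ) 2))
    refine (h.unique (hasSum_single j fun i hi => ?_)).trans ?_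
    · simp [coordProj_apply, hi]
    · simp [coordProj_apply]
  · refine isCompactOperator_of_tendsto hs.hasSum (.of_forall fun s => ?_)
    exact Submodule.sum_mem (compactOperator (RingHom.id ℂ) _ _)
      fun i _ => (isCompactOperator_coordProj i).smul (d i)

end Diagonal

theorem gq_nonneg (q : ℝ) (k : ℕ) : 0 ≤ gq q k := Real.sqrt_nonneg _

theorem gq_le_one (q : ℝ) (k : ℕ) : gq q k ≤ 1 := by
  have : 0 ≤ q ^ (2 * k) := (even_two_mul k).pow_nonneg q
  exact Real.sqrt_le_one.2 (by linarith)

theorem gq_mono {q : ℝ} (h1 : |q| < 1) : Monotone (gq q) := fun m n h => by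
  have : |q| ^ (2 * n) ≤ |q| ^ (2 * m) :=
    pow_le_pow_of_le_one (abs_nonneg q) h1.le (by omega)
  rw [(even_two_mul n).pow_abs, (even_two_mul m).pow_abs] at this
  exact Real.sqrt_le_sqrt (by linarith)

theorem sq_gq {q : ℝ} (h1 : |q| < 1) (k : ℕ) : gq q k ^ 2 = 1 - |q| ^ (2 * k) := by
  have : |q| ^ (2 * k) ≤ 1 := pow_le_one₀ (abs_nonneg q) h1.le
  rw [(even_two_mul k).pow_abs] at this ⊢
  exact Real.sq_sqrt (by linarith)

theorem abs_d2_le {q : ℝ} (h1 : |q| < 1) (r s : ℕ) (t : ℤ) :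
    |d2 q r s t| ≤ 1 / (1 - |q| ^ 2) * |q| ^ (2 * r + 2 * s + 2 * t.natAbs) := by
  set n := r + s + t.natAbs
  have hq : |q| ^ 2 < 1 := pow_lt_one₀ (abs_nonneg q) h1 two_ne_zero
  have hx : |q| ^ (2 * (n + 1)) ≤ |q| ^ (2 * r + 2 * s + 2 * t.natAbs) :=
    pow_le_pow_of_le_one (abs_nonneg q) h1.le (by omega)
  have hx2 : |q| ^ (2 * (n + 1)) ≤ |q| ^ 2 :=
    pow_le_pow_of_le_one (abs_nonneg q) h1.le (by omega)
  have hlow : 1 - |q| ^ (2 * (n + 1)) ≤ gq q (n + 1) * gq q (n + 2) := by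
    rw [← sq_gq h1, sq]
    exact mul_le_mul_of_nonneg_left (gq_mono h1 (by omega)) (gq_nonneg _ _)
  have hup : gq q (n + 1) * gq q (n + 2) ≤ 1 :=
    mul_le_one₀ (gq_le_one _ _) (gq_nonneg _ _) (gq_le_one _ _)
  have hA0 : 0 ≤ gq q (s + 1) * gq q (s + t.natAbs + 1) :=
    mul_nonneg (gq_nonneg _ _) (gq_nonneg _ _)
  have hA1 : gq q (s + 1) * gq q (s + t.natAbs + 1) ≤ 1 :=
    mul_le_one₀ (gq_le_one _ _) (gq_nonneg _ _) (gq_le_one _ _)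
  change |gq q (s + 1) * gq q (s + t.natAbs + 1) *
    (1 / (gq q (n + 1) * gq q (n + 2)) - 1)| ≤ _
  set p := gq q (n + 1) * gq q (n + 2)
  have hp : 0 < p := by linarith
  have hB : 1 / p - 1 = (1 - p) / p := by field_simp
  have hB0 : 0 ≤ (1 - p) / p := div_nonneg (by linarith) hp.le
  rw [hB, abs_of_nonneg (mul_nonneg hA0 hB0)]
  refine (mul_le_of_le_one_left hB0 hA1).trans ?_
  rw [one_div_mul_eq_div]
  exact div_le_div₀ (by positivity) (by linarith) (by linarith) (by linarith)

theorem summable_abs_pow {q : ℝ} (h1 : |q| < 1) :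
    Summable fun i : ℕ × ℕ × ℤ => |q| ^ (2 * i.1 + 2 * i.2.1 + 2 * i.2.2.natAbs) := by
  have hq : |q| ^ 2 < 1 := pow_lt_one₀ (abs_nonneg q) h1 two_ne_zero
  have hN : Summable fun n : ℕ => (|q| ^ 2) ^ n :=
    summable_geometric_of_lt_one (by positivity) hq
  have hZ : Summable fun t : ℤ => (|q| ^ 2) ^ t.natAbs :=
    Summable.of_nat_of_neg (by simpa using hN) (by simpa using hN)
  have hNZ := hN.mul_of_nonneg hZ (fun _ => by positivity) fun _ => by positivity
  refine (hN.mul_of_nonneg hNZ (fun _ => by positivity) fun _ => by positivity).congr fun i => ?_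
  simp only [← pow_mul, ← pow_add, add_assoc]

/-- the diagonal operator with symbol d₂ is compact; moreover
|d₂(r,s,t)| ≤ C·|q|^{2r+2s+2|t|} for some C > 0. -/
theorem stmt13 (q : ℝ) (h0 : 0 < |q|) (h1 : |q| < 1) :
    (∃ D : l2Z3 →L[ℂ] l2Z3,
      (∀ (r s : ℕ) (t : ℤ), D (e3 r s t) = ((d2 q r s t : ℝ) : ℂ) • e3 r s t) ∧
      IsCompactOperator (⇑D)) ∧
    ∃ C : ℝ, 0 < C ∧ ∀ (r s : ℕ) (t : ℤ),
      |d2 q r s t| ≤ C * |q| ^ (2 * r + 2 * s + 2 * t.natAbs) := by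
  have hq : |q| ^ 2 < 1 := pow_lt_one₀ (abs_nonneg q) h1 two_ne_zero
  refine ⟨?_, 1 / (1 - |q| ^ 2), one_div_pos.2 (sub_pos.2 hq), abs_d2_le h1⟩
  have hd : Summable fun i : ℕ × ℕ × ℤ => ‖((d2 q i.1 i.2.1 i.2.2 : ℝ) : ℂ)‖ := by
    refine Summable.of_nonneg_of_le (fun _ => norm_nonneg _) (fun i => ?_)
      ((summable_abs_pow h1).mul_left (1 / (1 - |q| ^ 2)))
    rw [Complex.norm_real]
    exact abs_d2_le h1 _ _ _
  obtain ⟨D, hD, hc⟩ := exists_isCompactOperator_diagonal hd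
  exact ⟨D, fun r s t => hD (r, s, t), hc⟩
end
end
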